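/- For every polynomial function w : ℝ² → ℝ of degree at most 3, ∫_K ‖∇²w − Π_HHJ(∇²w)‖_F² dx = F(w, K) · |K|, where ‖·‖_F is the Frobenius norm and F(w, K) := Σ_{i,j=1}^{4} γ^{ij} ∫_K D^{σ_i}w · D^{σ_j}w dx with σ₁ = (3,0), σ₂ = (2,1), σ₃ = (1,2), σ₄ = (0,3). -/

import Mathlib

noncomputable section
open MeasureTheory

namespace PaperStmt

/-- Euclidean dot product on `ℝ²`. -/
def dotp (v w : ℝ × ℝ) : ℝ := v.1 * w.1 + v.2 * w.2

/-- Euclidean length on `ℝ²`. -/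
def len (v : ℝ × ℝ) : ℝ := Real.sqrt (v.1 ^ 2 + v.2 ^ 2)

/-- Cross product (determinant) of two planar vectors. -/
def crossp (v w : ℝ × ℝ) : ℝ := v.1 * w.2 - v.2 * w.1

/-- The vertices `p 0, p 1, p 2` form a nondegenerate triangle listed counterclockwise. -/
def Ccw (p : Fin 3 → ℝ × ℝ) : Prop := 0 < crossp (p 1 - p 0) (p 2 - p 0)

/-- Vector of the edge `e_i` opposite vertex `p i`, oriented counterclockwise
(from `p (i+1)` to `p (i−1)`). -/
def edgeVec (p : Fin 3 → ℝ × ℝ) (i : Fin 3) : ℝ × ℝ := p (i - 1) - p (i + 1)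

/-- Length `|e_i|` of the edge opposite vertex `p i`. -/
def elen (p : Fin 3 → ℝ × ℝ) (i : Fin 3) : ℝ := len (edgeVec p i)

/-- Unit tangent `t_i = (p_{i−1} − p_{i+1})/|e_i|` of edge `e_i`. -/
def tvec (p : Fin 3 → ℝ × ℝ) (i : Fin 3) : ℝ × ℝ := (elen p i)⁻¹ • edgeVec p i

/-- Outward unit normal `n_i` of edge `e_i` (clockwise rotation of the tangent,
which points outward for a counterclockwise triangle). -/
def nvec (p : Fin 3 → ℝ × ℝ) (i : Fin 3) : ℝ × ℝ := ((tvec p i).2, -(tvec p i).1)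

/-- Interior angle `θ_i` of the triangle at the vertex `p i`. -/
def angleAt (p : Fin 3 → ℝ × ℝ) (i : Fin 3) : ℝ :=
  Real.arccos (dotp (p (i + 1) - p i) (p (i - 1) - p i) /
    (len (p (i + 1) - p i) * len (p (i - 1) - p i)))

/-- Outer product `v wᵀ` of two planar (column) vectors, as a `2 × 2` matrix. -/
def outerProd (v w : ℝ × ℝ) : Matrix (Fin 2) (Fin 2) ℝ :=
  !![v.1 * w.1, v.1 * w.2; v.2 * w.1, v.2 * w.2]

/-- Basis matrices `φ_HHJ^i = −(1/(2 sin θ_{i−1} sin θ_{i+1})) (t_{i−1} t_{i+1}ᵀ + t_{i+1} t_{i−1}ᵀ)`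
of the lowest-order Hellan–Herrmann–Johnson element. -/
def phiHHJ (p : Fin 3 → ℝ × ℝ) (i : Fin 3) : Matrix (Fin 2) (Fin 2) ℝ :=
  (-(2 * Real.sin (angleAt p (i - 1)) * Real.sin (angleAt p (i + 1)))⁻¹) •
    (outerProd (tvec p (i - 1)) (tvec p (i + 1)) + outerProd (tvec p (i + 1)) (tvec p (i - 1)))

/-- The quadratic form `vᵀ τ v` of a `2 × 2` matrix on a planar vector. -/
def qf (τ : Matrix (Fin 2) (Fin 2) ℝ) (v : ℝ × ℝ) : ℝ :=
  v.1 * (τ 0 0 * v.1 + τ 0 1 * v.2) + v.2 * (τ 1 0 * v.1 + τ 1 1 * v.2)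

end PaperStmt

namespace PaperStmt

/-- Directional derivative of `f` along `v`. -/
def dderiv (v : ℝ × ℝ) (f : ℝ × ℝ → ℝ) : ℝ × ℝ → ℝ := fun x => fderiv ℝ f x v

/-- Second directional derivative `D²f[u, v]`. -/
def d2 (u v : ℝ × ℝ) (f : ℝ × ℝ → ℝ) : ℝ × ℝ → ℝ := dderiv u (dderiv v f)

/-- Third directional derivative `D³f[u, v, w]`. -/
def d3 (u v w : ℝ × ℝ) (f : ℝ × ℝ → ℝ) : ℝ × ℝ → ℝ := dderiv u (dderiv v (dderiv w f))

end PaperStmt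

namespace PaperStmt

/-- Area `|K|` of the (counterclockwise) triangle with vertices `p`. -/
def area (p : Fin 3 → ℝ × ℝ) : ℝ := crossp (p 1 - p 0) (p 2 - p 0) / 2

/-- Centroid `M_K` of the triangle with vertices `p`. -/
def centroid (p : Fin 3 → ℝ × ℝ) : ℝ × ℝ := (3 : ℝ)⁻¹ • (p 0 + p 1 + p 2)

/-- The (closed) triangle `K` with vertices `p`, as a subset of `ℝ²`. -/
def tri (p : Fin 3 → ℝ × ℝ) : Set (ℝ × ℝ) := convexHull ℝ {p 0, p 1, p 2}

/-- The cubic polynomials `φ₁, φ₂, φ₃, φ₄` centered at the centroid: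
`φ₁ = (x₁−M₁)³/(6|K|^{1/2})`, `φ₂ = (x₁−M₁)²(x₂−M₂)/(2|K|^{1/2})`,
`φ₃ = (x₁−M₁)(x₂−M₂)²/(2|K|^{1/2})`, `φ₄ = (x₂−M₂)³/(6|K|^{1/2})`. -/
def phiK (p : Fin 3 → ℝ × ℝ) : Fin 4 → ℝ × ℝ → ℝ :=
  ![fun x => (x.1 - (centroid p).1) ^ 3 / (6 * Real.sqrt (area p)),
    fun x => (x.1 - (centroid p).1) ^ 2 * (x.2 - (centroid p).2) / (2 * Real.sqrt (area p)),
    fun x => (x.1 - (centroid p).1) * (x.2 - (centroid p).2) ^ 2 / (2 * Real.sqrt (area p)),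
    fun x => (x.2 - (centroid p).2) ^ 3 / (6 * Real.sqrt (area p))]

/-- Hessian `∇²f` of a scalar function on `ℝ²`, as a `2 × 2` matrix field. -/
def hess (f : ℝ × ℝ → ℝ) (x : ℝ × ℝ) : Matrix (Fin 2) (Fin 2) ℝ :=
  !![d2 (1, 0) (1, 0) f x, d2 (1, 0) (0, 1) f x;
     d2 (0, 1) (1, 0) f x, d2 (0, 1) (0, 1) f x]

/-- Frobenius inner product `A : B` of two `2 × 2` matrices. -/
def frob (A B : Matrix (Fin 2) (Fin 2) ℝ) : ℝ := ∑ i : Fin 2, ∑ j : Fin 2, A i j * B i j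

/-- Mean value `(1/|e_j|) ∫_{e_j} g ds` of `g` over the edge `e_j` (with respect to
arclength measure), computed by the unit-speed-normalized parametrization of `e_j`. -/
def edgeAvg (p : Fin 3 → ℝ × ℝ) (j : Fin 3) (g : ℝ × ℝ → ℝ) : ℝ :=
  ∫ s in (0:ℝ)..1, g (p (j + 1) + s • (p (j - 1) - p (j + 1)))

/-- The Hellan–Herrmann–Johnson interpolant
`Π_HHJ τ = Σ_{j=1}^{3} ((1/|e_j|) ∫_{e_j} n_jᵀ τ n_j ds) φ_HHJ^j` of a
matrix-valued field `τ`, a constant symmetric matrix. -/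
def PiHHJ (p : Fin 3 → ℝ × ℝ) (τ : ℝ × ℝ → Matrix (Fin 2) (Fin 2) ℝ) :
    Matrix (Fin 2) (Fin 2) ℝ :=
  ∑ j : Fin 3, edgeAvg p j (fun x => qf (τ x) (nvec p j)) • phiHHJ p j

/-- The constants `γ^{ij} = (1/|K|) ∫_K ((I − Π_HHJ)∇²φ_i) : ((I − Π_HHJ)∇²φ_j) dx`. -/
def gammaHHJ (p : Fin 3 → ℝ × ℝ) (i j : Fin 4) : ℝ :=
  (area p)⁻¹ *
    ∫ x in tri p,
      frob (hess (phiK p i) x - PiHHJ p (hess (phiK p i)))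
           (hess (phiK p j) x - PiHHJ p (hess (phiK p j)))

/-- Coefficients `a₁ = |K|^{1/2} ∂³w/∂x₁³`, `a₂ = |K|^{1/2} ∂³w/∂x₁²∂x₂`,
`a₃ = |K|^{1/2} ∂³w/∂x₁∂x₂²`, `a₄ = |K|^{1/2} ∂³w/∂x₂³` (the third partial
derivatives of a cubic polynomial being constant, they are evaluated at `0`). -/
def acoef (p : Fin 3 → ℝ × ℝ) (w : ℝ × ℝ → ℝ) : Fin 4 → ℝ :=
  ![Real.sqrt (area p) * d3 (1, 0) (1, 0) (1, 0) w 0,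
    Real.sqrt (area p) * d3 (1, 0) (1, 0) (0, 1) w 0,
    Real.sqrt (area p) * d3 (1, 0) (0, 1) (0, 1) w 0,
    Real.sqrt (area p) * d3 (0, 1) (0, 1) (0, 1) w 0]

end PaperStmt

namespace PaperStmt

/-- `f : ℝ² → ℝ` is a polynomial function of (total) degree at most `l`. -/
def IsPolyFun (l : ℕ) (f : ℝ × ℝ → ℝ) : Prop :=
  ∃ q : MvPolynomial (Fin 2) ℝ, q.totalDegree ≤ l ∧
    ∀ x : ℝ × ℝ, f x = MvPolynomial.eval ![x.1, x.2] q

end PaperStmt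

namespace PaperStmt

/-- The four third-order partial derivatives `D^{σ_i} w` with
`σ₁ = (3,0)`, `σ₂ = (2,1)`, `σ₃ = (1,2)`, `σ₄ = (0,3)`. -/
def thirdD (w : ℝ × ℝ → ℝ) : Fin 4 → ℝ × ℝ → ℝ :=
  ![d3 (1, 0) (1, 0) (1, 0) w,
    d3 (1, 0) (1, 0) (0, 1) w,
    d3 (1, 0) (0, 1) (0, 1) w,
    d3 (0, 1) (0, 1) (0, 1) w]

end PaperStmt

namespace PaperStmt

/-- Cubic polynomial centered at `m`, with coefficients of the monomials
1, X, Y, X², XY, Y², X³, X²Y, XY², Y³. -/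
def cub (m : ℝ × ℝ) (c0 c1 c2 c3 c4 c5 c6 c7 c8 c9 : ℝ) (x : ℝ × ℝ) : ℝ :=
  c0 + c1 * (x.1 - m.1) + c2 * (x.2 - m.2) + c3 * (x.1 - m.1) ^ 2
    + c4 * ((x.1 - m.1) * (x.2 - m.2)) + c5 * (x.2 - m.2) ^ 2
    + c6 * (x.1 - m.1) ^ 3 + c7 * ((x.1 - m.1) ^ 2 * (x.2 - m.2))
    + c8 * ((x.1 - m.1) * (x.2 - m.2) ^ 2) + c9 * (x.2 - m.2) ^ 3

lemma dderiv_cub (m v : ℝ × ℝ) (c0 c1 c2 c3 c4 c5 c6 c7 c8 c9 : ℝ) :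
    dderiv v (cub m c0 c1 c2 c3 c4 c5 c6 c7 c8 c9) =
      cub m (v.1 * c1 + v.2 * c2) (v.1 * (2 * c3) + v.2 * c4) (v.1 * c4 + v.2 * (2 * c5))
        (v.1 * (3 * c6) + v.2 * c7) (v.1 * (2 * c7) + v.2 * (2 * c8))
        (v.1 * c8 + v.2 * (3 * c9)) 0 0 0 0 := by
  funext x
  have h1 : HasFDerivAt (fun x : ℝ × ℝ => x.1 - m.1) (ContinuousLinearMap.fst ℝ ℝ ℝ) x :=
    hasFDerivAt_fst.sub_const _
  have h2 : HasFDerivAt (fun x : ℝ × ℝ => x.2 - m.2) (ContinuousLinearMap.snd ℝ ℝ ℝ) x :=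
    hasFDerivAt_snd.sub_const _
  have H := (((((((((hasFDerivAt_const c0 x).add (h1.const_mul c1)).add (h2.const_mul c2)).add
    ((h1.pow 2).const_mul c3)).add ((h1.mul h2).const_mul c4)).add ((h2.pow 2).const_mul c5)).add
    ((h1.pow 3).const_mul c6)).add (((h1.pow 2).mul h2).const_mul c7)).add
    ((h1.mul (h2.pow 2)).const_mul c8)).add ((h2.pow 3).const_mul c9)
  have e : fderiv ℝ (cub m c0 c1 c2 c3 c4 c5 c6 c7 c8 c9) x = _ := HasFDerivAt.fderiv H
  unfold dderiv
  rw [e]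
  simp [cub]
  ring

lemma hess_cub (m : ℝ × ℝ) (c0 c1 c2 c3 c4 c5 c6 c7 c8 c9 : ℝ) (x : ℝ × ℝ) :
    hess (cub m c0 c1 c2 c3 c4 c5 c6 c7 c8 c9) x =
      !![2 * c3 + 6 * c6 * (x.1 - m.1) + 2 * c7 * (x.2 - m.2),
         c4 + 2 * c7 * (x.1 - m.1) + 2 * c8 * (x.2 - m.2);
         c4 + 2 * c7 * (x.1 - m.1) + 2 * c8 * (x.2 - m.2),
         2 * c5 + 2 * c8 * (x.1 - m.1) + 6 * c9 * (x.2 - m.2)] := by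
  unfold hess d2
  simp only [dderiv_cub]
  ext i j
  fin_cases i <;> fin_cases j <;> simp [cub] <;> first | ring1 | (left; ring1)

lemma thirdD_cub (m : ℝ × ℝ) (c0 c1 c2 c3 c4 c5 c6 c7 c8 c9 : ℝ) (i : Fin 4) (x : ℝ × ℝ) :
    thirdD (cub m c0 c1 c2 c3 c4 c5 c6 c7 c8 c9) i x =
      (![6 * c6, 2 * c7, 2 * c8, 6 * c9] : Fin 4 → ℝ) i := by
  unfold thirdD d3
  simp only [dderiv_cub]
  fin_cases i <;> simp [cub] <;> ring

lemma exists_cub (m : ℝ × ℝ) (w : ℝ × ℝ → ℝ) (hw : IsPolyFun 3 w) :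
    ∃ c0 c1 c2 c3 c4 c5 c6 c7 c8 c9 : ℝ, w = cub m c0 c1 c2 c3 c4 c5 c6 c7 c8 c9 := by
  obtain ⟨q, hq, hwq⟩ := hw
  suffices h : ∃ c0 c1 c2 c3 c4 c5 c6 c7 c8 c9 : ℝ, w = cub 0 c0 c1 c2 c3 c4 c5 c6 c7 c8 c9 by
    obtain ⟨c0, c1, c2, c3, c4, c5, c6, c7, c8, c9, rfl⟩ := h
    obtain ⟨a, b⟩ := m
    refine ⟨cub 0 c0 c1 c2 c3 c4 c5 c6 c7 c8 c9 (a, b),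
      c1 + 2 * c3 * a + c4 * b + 3 * c6 * a ^ 2 + 2 * c7 * a * b + c8 * b ^ 2,
      c2 + 2 * c5 * b + c4 * a + 3 * c9 * b ^ 2 + 2 * c8 * a * b + c7 * a ^ 2,
      c3 + 3 * c6 * a + c7 * b, c4 + 2 * c7 * a + 2 * c8 * b, c5 + 3 * c9 * b + c8 * a,
      c6, c7, c8, c9, ?_⟩
    funext x
    simp only [cub, Prod.fst_zero, Prod.snd_zero]
    ring
  have hw' : w = fun x => ∑ d ∈ q.support, q.coeff d * (x.1 ^ d 0 * x.2 ^ d 1) := by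
    funext x
    rw [hwq, MvPolynomial.eval_eq']
    simp [Fin.prod_univ_two]
  rw [hw']
  have key : ∀ s : Finset (Fin 2 →₀ ℕ), s ⊆ q.support →
      ∃ c0 c1 c2 c3 c4 c5 c6 c7 c8 c9 : ℝ,
      (fun x : ℝ × ℝ => ∑ d ∈ s, q.coeff d * (x.1 ^ d 0 * x.2 ^ d 1)) =
        cub 0 c0 c1 c2 c3 c4 c5 c6 c7 c8 c9 := by
    intro s
    induction s using Finset.induction_on with
    | empty => intro _; exact ⟨0, 0, 0, 0, 0, 0, 0, 0, 0, 0, by funext x; simp [cub]⟩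
    | insert d s hd ih =>
      intro hs
      obtain ⟨c0, c1, c2, c3, c4, c5, c6, c7, c8, c9, h⟩ :=
        ih (fun _ ht => hs (Finset.mem_insert_of_mem ht))
      have hdeg : d 0 + d 1 ≤ 3 := by
        have h1 := MvPolynomial.le_totalDegree (hs (Finset.mem_insert_self d s))
        rw [Finsupp.sum_fintype _ _ (fun _ => rfl), Fin.sum_univ_two] at h1
        exact h1.trans hq
      have hx : ∀ x : ℝ × ℝ, ∑ d ∈ insert d s, q.coeff d * (x.1 ^ d 0 * x.2 ^ d 1) =
          q.coeff d * (x.1 ^ d 0 * x.2 ^ d 1) + cub 0 c0 c1 c2 c3 c4 c5 c6 c7 c8 c9 x := by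
        intro x
        rw [Finset.sum_insert hd, ← h]
      simp only [hx]
      generalize q.coeff d = k
      generalize d 0 = a at hdeg
      generalize d 1 = b at hdeg
      obtain ⟨δ, hδ⟩ : ∃ δ : ℕ → ℕ → ℝ, ∀ i j, δ i j = if a = i ∧ b = j then k else 0 :=
        ⟨_, fun _ _ => rfl⟩
      refine ⟨c0 + δ 0 0, c1 + δ 1 0, c2 + δ 0 1, c3 + δ 2 0, c4 + δ 1 1, c5 + δ 0 2,
        c6 + δ 3 0, c7 + δ 2 1, c8 + δ 1 2, c9 + δ 0 3, ?_⟩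
      funext x
      have ha : a ≤ 3 := by omega
      interval_cases a
      all_goals
        have hb : b ≤ 3 := by omega
        interval_cases b
        all_goals first | omega | (simp [cub, hδ]; try ring)
  exact key _ subset_rfl

lemma phiK_eq (p : Fin 3 → ℝ × ℝ) (i : Fin 4) :
    phiK p i = cub (centroid p) 0 0 0 0 0 0
      ((![1, 0, 0, 0] : Fin 4 → ℝ) i / (6 * Real.sqrt (area p)))
      ((![0, 1, 0, 0] : Fin 4 → ℝ) i / (2 * Real.sqrt (area p)))
      ((![0, 0, 1, 0] : Fin 4 → ℝ) i / (2 * Real.sqrt (area p)))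
      ((![0, 0, 0, 1] : Fin 4 → ℝ) i / (6 * Real.sqrt (area p))) := by
  funext x
  fin_cases i <;> simp [phiK, cub] <;> ring

end PaperStmt
namespace PaperStmt

lemma sin_arccos_aux (a b d c : ℝ) (ha : 0 < a) (hb : 0 < b) (hc : 0 < c)
    (h : a ^ 2 * b ^ 2 = d ^ 2 + c ^ 2) :
    Real.sin (Real.arccos (d / (a * b))) = c / (a * b) := by
  rw [Real.sin_arccos]
  have hab : 0 < a * b := mul_pos ha hb
  have : 1 - (d / (a * b)) ^ 2 = (c / (a * b)) ^ 2 := by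
    field_simp
    nlinarith
  rw [this, Real.sqrt_sq (by positivity)]

lemma len_sq (v : ℝ × ℝ) : len v ^ 2 = v.1 ^ 2 + v.2 ^ 2 := by
  unfold len; rw [Real.sq_sqrt (by positivity)]

lemma len_pos_of_crossp (u v : ℝ × ℝ) (h : 0 < crossp u v) : 0 < len u ∧ 0 < len v := by
  unfold len crossp at *
  constructor
  · apply Real.sqrt_pos.2
    by_contra hn
    have h1 : u.1 = 0 := by nlinarith [sq_nonneg u.1, sq_nonneg u.2]
    have h2 : u.2 = 0 := by nlinarith [sq_nonneg u.1, sq_nonneg u.2]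
    simp [h1, h2] at h
  · apply Real.sqrt_pos.2
    by_contra hn
    have h1 : v.1 = 0 := by nlinarith [sq_nonneg v.1, sq_nonneg v.2]
    have h2 : v.2 = 0 := by nlinarith [sq_nonneg v.1, sq_nonneg v.2]
    simp [h1, h2] at h

lemma crossp_vertex (p : Fin 3 → ℝ × ℝ) (i : Fin 3) :
    crossp (p (i + 1) - p i) (p (i - 1) - p i) = crossp (p 1 - p 0) (p 2 - p 0) := by
  fin_cases i
  · rfl
  · change crossp (p 2 - p 1) (p 0 - p 1) = _
    simp only [crossp, Prod.fst_sub, Prod.snd_sub]; ring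
  · change crossp (p 0 - p 2) (p 1 - p 2) = _
    simp only [crossp, Prod.fst_sub, Prod.snd_sub]; ring

lemma len_neg_sub (u v : ℝ × ℝ) : len (u - v) = len (v - u) := by
  unfold len; congr 1; simp only [Prod.fst_sub, Prod.snd_sub]; ring

lemma sin_angleAt (p : Fin 3 → ℝ × ℝ) (hp : Ccw p) (i : Fin 3) :
    Real.sin (angleAt p i) =
      crossp (p 1 - p 0) (p 2 - p 0) / (elen p (i - 1) * elen p (i + 1)) := by
  have hc : 0 < crossp (p (i + 1) - p i) (p (i - 1) - p i) := by rw [crossp_vertex]; exact hp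
  obtain ⟨h1, h2⟩ := len_pos_of_crossp _ _ hc
  have e1 : elen p (i - 1) = len (p (i + 1) - p i) := by
    unfold elen edgeVec
    rw [show i - 1 - 1 = i + 1 by fin_cases i <;> rfl, show i - 1 + 1 = i by fin_cases i <;> rfl]
  have e2 : elen p (i + 1) = len (p (i - 1) - p i) := by
    unfold elen edgeVec
    rw [show i + 1 - 1 = i by fin_cases i <;> rfl, show i + 1 + 1 = i - 1 by fin_cases i <;> rfl,
      len_neg_sub]
  unfold angleAt
  rw [sin_arccos_aux _ _ _ _ h1 h2 hc, crossp_vertex, e1, e2]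
  rw [len_sq, len_sq]
  simp only [dotp, crossp]; ring

lemma elen_pos (p : Fin 3 → ℝ × ℝ) (hp : Ccw p) (i : Fin 3) : 0 < elen p i := by
  have hc : 0 < crossp (p (i - 1 + 1) - p (i - 1)) (p (i - 1 - 1) - p (i - 1)) := by
    rw [crossp_vertex]; exact hp
  have hc : 0 < crossp (p (i + 1 + 1) - p (i + 1)) (p (i + 1 - 1) - p (i + 1)) := by
    rw [crossp_vertex]; exact hp
  have := (len_pos_of_crossp _ _ hc).1
  rw [show i + 1 + 1 = i - 1 by fin_cases i <;> rfl] at this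
  exact this

lemma edgeAvg_const (p : Fin 3 → ℝ × ℝ) (j : Fin 3) (k : ℝ) :
    edgeAvg p j (fun _ => k) = k := by simp [edgeAvg]

lemma summand_eq (p : Fin 3 → ℝ × ℝ) (hp : Ccw p) (j : Fin 3) (C : Matrix (Fin 2) (Fin 2) ℝ) :
    qf C (nvec p j) • phiHHJ p j =
      (-(qf C ((edgeVec p j).2, -(edgeVec p j).1)) /
        (2 * crossp (p 1 - p 0) (p 2 - p 0) ^ 2)) •
        (outerProd (edgeVec p (j - 1)) (edgeVec p (j + 1)) +
          outerProd (edgeVec p (j + 1)) (edgeVec p (j - 1))) := by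
  have hD : crossp (p 1 - p 0) (p 2 - p 0) ≠ 0 := ne_of_gt hp
  have h0 := (elen_pos p hp j).ne'
  have h1 := (elen_pos p hp (j - 1)).ne'
  have h2 := (elen_pos p hp (j + 1)).ne'
  unfold phiHHJ
  rw [sin_angleAt p hp, sin_angleAt p hp]
  rw [show j - 1 - 1 = j + 1 by fin_cases j <;> rfl, show j - 1 + 1 = j by fin_cases j <;> rfl,
    show j + 1 - 1 = j by fin_cases j <;> rfl, show j + 1 + 1 = j - 1 by fin_cases j <;> rfl]
  unfold nvec tvec
  generalize elen p j = l0 at *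
  generalize elen p (j - 1) = l1 at *
  generalize elen p (j + 1) = l2 at *
  generalize crossp (p 1 - p 0) (p 2 - p 0) = D at *
  ext a b
  fin_cases a <;> fin_cases b <;> simp [outerProd, qf] <;> field_simp <;> ring

lemma PiHHJ_const (p : Fin 3 → ℝ × ℝ) (hp : Ccw p) (a b c : ℝ) :
    PiHHJ p (fun _ => !![a, b; b, c]) = !![a, b; b, c] := by
  unfold PiHHJ
  simp only [edgeAvg_const, summand_eq p hp]
  have hD : crossp (p 1 - p 0) (p 2 - p 0) ≠ 0 := ne_of_gt hp
  rw [Fin.sum_univ_three]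
  unfold edgeVec
  rw [show (0 : Fin 3) - 1 = 2 by rfl, show (0 : Fin 3) + 1 = 1 by rfl,
    show (1 : Fin 3) - 1 = 0 by rfl, show (1 : Fin 3) + 1 = 2 by rfl,
    show (2 : Fin 3) - 1 = 1 by rfl, show (2 : Fin 3) + 1 = 0 by rfl]
  rw [show (0 : Fin 3) - 1 = 2 by rfl, show (0 : Fin 3) + 1 = 1 by rfl,
    show (1 : Fin 3) - 1 = 0 by rfl, show (1 : Fin 3) + 1 = 2 by rfl]
  generalize p 0 = u at *
  generalize p 1 = v at *
  generalize p 2 = w at *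
  obtain ⟨u1, u2⟩ := u
  obtain ⟨v1, v2⟩ := v
  obtain ⟨w1, w2⟩ := w
  simp only [crossp, Prod.mk_sub_mk] at hD
  ext i j
  fin_cases i <;> fin_cases j <;> simp [outerProd, qf, crossp] <;> field_simp <;> ring

end PaperStmt
namespace PaperStmt

lemma PiHHJ_add (p : Fin 3 → ℝ × ℝ) (τ σ : ℝ × ℝ → Matrix (Fin 2) (Fin 2) ℝ)
    (hτ : Continuous τ) (hσ : Continuous σ) :
    PiHHJ p (fun x => τ x + σ x) = PiHHJ p τ + PiHHJ p σ := by
  unfold PiHHJ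
  rw [← Finset.sum_add_distrib]
  refine Finset.sum_congr rfl fun j _ => ?_
  rw [← add_smul]
  congr 1
  unfold edgeAvg
  have hc : ∀ ρ : ℝ × ℝ → Matrix (Fin 2) (Fin 2) ℝ, Continuous ρ → Continuous
      (fun s : ℝ => qf (ρ (p (j + 1) + s • (p (j - 1) - p (j + 1)))) (nvec p j)) := by
    intro ρ hρ
    unfold qf
    have hm : ∀ a b, Continuous fun x => ρ x a b := fun a b => hρ.matrix_elem a b
    have := hm 0 0
    have := hm 0 1
    have := hm 1 0
    have := hm 1 1
    fun_prop
  rw [← intervalIntegral.integral_add ((hc τ hτ).intervalIntegrable _ _)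
    ((hc σ hσ).intervalIntegrable _ _)]
  congr 1
  funext s
  simp only [qf, Matrix.add_apply]
  ring

lemma PiHHJ_smul (p : Fin 3 → ℝ × ℝ) (a : ℝ) (τ : ℝ × ℝ → Matrix (Fin 2) (Fin 2) ℝ) :
    PiHHJ p (fun x => a • τ x) = a • PiHHJ p τ := by
  unfold PiHHJ
  rw [Finset.smul_sum]
  refine Finset.sum_congr rfl fun j _ => ?_
  rw [smul_smul]
  congr 1
  unfold edgeAvg
  rw [← intervalIntegral.integral_const_mul]
  congr 1
  funext s
  simp only [qf, Matrix.smul_apply, smul_eq_mul]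
  ring

lemma PiHHJ_lin (p : Fin 3 → ℝ × ℝ) (C : Matrix (Fin 2) (Fin 2) ℝ) (a : Fin 4 → ℝ)
    (τ : Fin 4 → ℝ × ℝ → Matrix (Fin 2) (Fin 2) ℝ) (hτ : ∀ i, Continuous (τ i)) :
    PiHHJ p (fun x => C + ∑ i, a i • τ i x) =
      PiHHJ p (fun _ => C) + ∑ i, a i • PiHHJ p (τ i) := by
  have h : ∀ i, Continuous fun x => a i • τ i x := fun i => by
    have := hτ i
    fun_prop
  simp only [Fin.sum_univ_four]
  rw [PiHHJ_add p _ _ continuous_const (by fun_prop), PiHHJ_add p _ _ (by fun_prop) (h 3),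
    PiHHJ_add p _ _ (by fun_prop) (h 2), PiHHJ_add p _ _ (h 0) (h 1)]
  simp only [PiHHJ_smul]

/-- The reference triangle. -/
def refTri : Set (ℝ × ℝ) := {x | 0 ≤ x.1 ∧ 0 ≤ x.2 ∧ x.1 + x.2 ≤ 1}

lemma refTri_convex : Convex ℝ refTri := by
  rintro ⟨x1, x2⟩ ⟨h1, h2, h3⟩ ⟨y1, y2⟩ ⟨k1, k2, k3⟩ a b ha hb hab
  simp only at h1 h2 h3 k1 k2 k3
  refine ⟨?_, ?_, ?_⟩ <;> simp
  · positivity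
  · positivity
  · nlinarith

lemma refTri_closed : IsClosed refTri := by
  have h1 : IsClosed {x : ℝ × ℝ | 0 ≤ x.1} := isClosed_le (by fun_prop) (by fun_prop)
  have h2 : IsClosed {x : ℝ × ℝ | 0 ≤ x.2} := isClosed_le (by fun_prop) (by fun_prop)
  have h3 : IsClosed {x : ℝ × ℝ | x.1 + x.2 ≤ 1} := isClosed_le (by fun_prop) (by fun_prop)
  exact h1.inter (h2.inter h3)

lemma volume_refTri : volume refTri = ENNReal.ofReal (1 / 2) := by
  rw [Measure.volume_eq_prod, Measure.prod_apply refTri_closed.measurableSet]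
  have h : ∀ s : ℝ, volume (Prod.mk s ⁻¹' refTri) =
      (Set.Icc (0:ℝ) 1).indicator (fun s => ENNReal.ofReal (1 - s)) s := by
    intro s
    by_cases hs : s ∈ Set.Icc (0:ℝ) 1
    · rw [Set.indicator_of_mem hs]
      have : Prod.mk s ⁻¹' refTri = Set.Icc 0 (1 - s) := by
        ext t
        simp only [refTri, Set.mem_preimage, Set.mem_ofPred_eq, Set.mem_Icc]
        constructor
        · rintro ⟨_, h, h'⟩; exact ⟨h, by linarith⟩
        · rintro ⟨h, h'⟩; exact ⟨hs.1, h, by linarith⟩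
      rw [this, Real.volume_Icc, sub_zero]
    · rw [Set.indicator_of_notMem hs]
      have : Prod.mk s ⁻¹' refTri = ∅ := by
        ext t
        simp only [refTri, Set.mem_preimage, Set.mem_ofPred_eq, Set.mem_empty_iff_false, iff_false]
        rintro ⟨h1, h2, h3⟩
        exact hs ⟨h1, by linarith⟩
      rw [this, measure_empty]
  simp only [h]
  rw [lintegral_indicator measurableSet_Icc, ← ofReal_integral_eq_lintegral_ofReal]
  · congr 1
    rw [integral_Icc_eq_integral_Ioc, ← intervalIntegral.integral_of_le zero_le_one,
      intervalIntegral.integral_sub (by simp) (by simp)]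
    simp
    norm_num
  · exact (by fun_prop : Continuous fun s : ℝ => 1 - s).integrableOn_Icc
  · filter_upwards [ae_restrict_mem measurableSet_Icc] with s hs
    simpa using hs.2

lemma tri_eq (p : Fin 3 → ℝ × ℝ) :
    tri p = (fun x => p 0 + x) '' (Matrix.toLin (Module.Basis.finTwoProd ℝ) (Module.Basis.finTwoProd ℝ)
      !![(p 1 - p 0).1, (p 2 - p 0).1; (p 1 - p 0).2, (p 2 - p 0).2] '' refTri) := by
  set L := Matrix.toLin (Module.Basis.finTwoProd ℝ) (Module.Basis.finTwoProd ℝ)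
      !![(p 1 - p 0).1, (p 2 - p 0).1; (p 1 - p 0).2, (p 2 - p 0).2] with hL
  have hLx : ∀ x, L x = x.1 • (p 1 - p 0) + x.2 • (p 2 - p 0) := by
    intro x
    rw [hL, Matrix.toLin_finTwoProd_apply]
    ext <;> simp <;> ring
  apply Set.Subset.antisymm
  · apply convexHull_min
    · rintro x (rfl | rfl | rfl)
      · exact ⟨_, ⟨(0, 0), by simp [refTri], rfl⟩, by simp [hLx]⟩
      · exact ⟨_, ⟨(1, 0), by simp [refTri], rfl⟩, by simp [hLx]⟩
      · exact ⟨_, ⟨(0, 1), by simp [refTri], rfl⟩, by simp [hLx]⟩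
    · exact (refTri_convex.linear_image L).translate (p 0)
  · rintro _ ⟨_, ⟨⟨s, t⟩, ⟨h1, h2, h3⟩, rfl⟩, rfl⟩
    simp only at h1 h2 h3
    have hc : Convex ℝ (tri p) := convex_convexHull ℝ _
    have hm : ∀ i, p i ∈ tri p := by
      intro i
      apply subset_convexHull
      fin_cases i <;> simp
    have := hc.sum_mem (t := Finset.univ) (w := ![1 - s - t, s, t]) (z := p)
      (by intro i _; fin_cases i <;> simp <;> linarith) (by simp [Fin.sum_univ_three]; ring)
      (fun i _ => hm i)
    convert this using 1
    simp only [hLx, Fin.sum_univ_three]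
    ext <;> simp <;> ring

lemma volume_tri (p : Fin 3 → ℝ × ℝ) (hp : Ccw p) : volume.real (tri p) = area p := by
  have hv : volume (tri p) = ENNReal.ofReal (area p) := by
    rw [tri_eq, Set.image_add_left, measure_preimage_add, Measure.addHaar_image_linearMap, volume_refTri,
      LinearMap.det_toLin, ← ENNReal.ofReal_mul (abs_nonneg _)]
    congr 1
    rw [Matrix.det_fin_two_of]
    unfold Ccw crossp at hp
    unfold area crossp
    rw [abs_of_pos (by linarith)]
    ring
  rw [Measure.real, hv, ENNReal.toReal_ofReal]
  unfold area
  have : 0 < crossp (p 1 - p 0) (p 2 - p 0) := hp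
  positivity

lemma tri_compact (p : Fin 3 → ℝ × ℝ) : IsCompact (tri p) :=
  Set.Finite.isCompact_convexHull (𝕜 := ℝ) (by simp)

lemma frob_lin (a : Fin 4 → ℝ) (E : Fin 4 → Matrix (Fin 2) (Fin 2) ℝ) :
    frob (∑ i, a i • E i) (∑ i, a i • E i) = ∑ i, ∑ j, a i * a j * frob (E i) (E j) := by
  simp only [frob, Fin.sum_univ_four, Fin.sum_univ_two, Matrix.add_apply, Matrix.smul_apply,
    smul_eq_mul]
  ring

lemma hess_phiK_continuous (p : Fin 3 → ℝ × ℝ) (i : Fin 4) : Continuous (hess (phiK p i)) := by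
  rw [phiK_eq]
  apply continuous_matrix
  intro a b
  simp only [hess_cub]
  fin_cases a <;> fin_cases b <;> simp <;> fun_prop

lemma hess_decomp (p : Fin 3 → ℝ × ℝ) (hA : 0 < area p) (c0 c1 c2 c3 c4 c5 c6 c7 c8 c9 : ℝ)
    (x : ℝ × ℝ) :
    hess (cub (centroid p) c0 c1 c2 c3 c4 c5 c6 c7 c8 c9) x =
      !![2 * c3, c4; c4, 2 * c5] + ∑ i, (Real.sqrt (area p) *
        (![6 * c6, 2 * c7, 2 * c8, 6 * c9] : Fin 4 → ℝ) i) • hess (phiK p i) x := by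
  have h : Real.sqrt (area p) ≠ 0 := (Real.sqrt_pos.2 hA).ne'
  simp only [phiK_eq, hess_cub, Fin.sum_univ_four]
  generalize Real.sqrt (area p) = r at *
  ext i j
  fin_cases i <;> fin_cases j <;> simp <;> field_simp <;> ring

lemma main_aux
    (p : Fin 3 → ℝ × ℝ) (hp : Ccw p)
    (w : ℝ × ℝ → ℝ) (hw : IsPolyFun 3 w) :
    (∫ x in tri p,
        frob (hess w x - PiHHJ p (hess w)) (hess w x - PiHHJ p (hess w))) =
      (∑ i : Fin 4, ∑ j : Fin 4,
        gammaHHJ p i j * ∫ x in tri p, thirdD w i x * thirdD w j x) * area p := by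
  have hA : 0 < area p := by
    have : 0 < crossp (p 1 - p 0) (p 2 - p 0) := hp
    unfold area; positivity
  obtain ⟨c0, c1, c2, c3, c4, c5, c6, c7, c8, c9, rfl⟩ := exists_cub (centroid p) w hw
  set D : Fin 4 → ℝ := ![6 * c6, 2 * c7, 2 * c8, 6 * c9] with hD
  set E : Fin 4 → ℝ × ℝ → Matrix (Fin 2) (Fin 2) ℝ :=
    fun i x => hess (phiK p i) x - PiHHJ p (hess (phiK p i)) with hE
  have hEc : ∀ i, Continuous (E i) := fun i => (hess_phiK_continuous p i).sub continuous_const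
  have hdec : hess (cub (centroid p) c0 c1 c2 c3 c4 c5 c6 c7 c8 c9) = fun x =>
      !![2 * c3, c4; c4, 2 * c5] + ∑ i, (Real.sqrt (area p) * D i) • hess (phiK p i) x :=
    funext fun x => hess_decomp p hA c0 c1 c2 c3 c4 c5 c6 c7 c8 c9 x
  have herr : ∀ x, hess (cub (centroid p) c0 c1 c2 c3 c4 c5 c6 c7 c8 c9) x
      - PiHHJ p (hess (cub (centroid p) c0 c1 c2 c3 c4 c5 c6 c7 c8 c9)) =
      ∑ i, (Real.sqrt (area p) * D i) • E i x := by
    intro x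
    rw [hdec, PiHHJ_lin p _ _ _ (hess_phiK_continuous p), PiHHJ_const p hp]
    simp only [hE, smul_sub, Finset.sum_sub_distrib]
    abel
  have hfc : ∀ i j, Continuous fun x => frob (E i x) (E j x) := by
    intro i j
    have hm : ∀ i a b, Continuous fun x => E i x a b := fun i a b => (hEc i).matrix_elem a b
    unfold frob
    exact continuous_finsetSum _ fun a _ => continuous_finsetSum _ fun b _ =>
      (hm i a b).mul (hm j a b)
  have hint : ∀ i j, IntegrableOn (fun x => (Real.sqrt (area p) * D i) *
      (Real.sqrt (area p) * D j) * frob (E i x) (E j x)) (tri p) volume := fun i j =>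
    (continuous_const.mul (hfc i j)).continuousOn.integrableOn_compact (tri_compact p)
  simp only [herr, frob_lin, thirdD_cub, ← hD]
  rw [integral_finsetSum _ fun i _ => integrable_finsetSum _ fun j _ => hint i j,
    Finset.sum_mul]
  refine Finset.sum_congr rfl fun i _ => ?_
  rw [integral_finsetSum _ fun j _ => hint i j, Finset.sum_mul]
  refine Finset.sum_congr rfl fun j _ => ?_
  rw [integral_const_mul, setIntegral_const, volume_tri p hp, smul_eq_mul]
  have hg : gammaHHJ p i j = (area p)⁻¹ * ∫ x in tri p, frob (E i x) (E j x) := rfl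
  rw [hg]
  have hs : Real.sqrt (area p) * Real.sqrt (area p) = area p := Real.mul_self_sqrt hA.le
  generalize (∫ x in tri p, frob (E i x) (E j x)) = I
  calc _ = (Real.sqrt (area p) * Real.sqrt (area p)) * (D i * D j * I) := by ring
    _ = _ := by rw [hs]; field_simp

end PaperStmt

open PaperStmt in
/-- For every polynomial `w` of degree ≤ 3,
`∫_K ‖∇²w − Π_HHJ(∇²w)‖_F² dx = (Σ_{i,j=1}^{4} γ^{ij} ∫_K D^{σ_i}w · D^{σ_j}w dx) · |K|`. -/
theorem hess_interp_error_L2_expansion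
    (p : Fin 3 → ℝ × ℝ) (hp : Ccw p)
    (w : ℝ × ℝ → ℝ) (hw : IsPolyFun 3 w) :
    (∫ x in tri p,
        frob (hess w x - PiHHJ p (hess w)) (hess w x - PiHHJ p (hess w))) =
      (∑ i : Fin 4, ∑ j : Fin 4,
        gammaHHJ p i j * ∫ x in tri p, thirdD w i x * thirdD w j x) * area p := by
  exact main_aux p hp w hw
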